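/- Fix k ∈ ℕ and a finitely supported family c : (Fin n →₀ ℕ) →₀ ℂ supported on multi-indices of total degree at most k. Let E := O₀/M^(k+1), a module over O₀ which is finite-dimensional over ℂ. Then there exists a ℂ-linear functional η on End_ℂ(E) such that for every open set Ω ⊆ ℂⁿ, every function f : ℂⁿ → ℂ analytic at each point of Ω, and every μ ∈ Ω: η(f^{(E)}(μ)) = Σ_α c_α · (∂^α f)(μ), where ∂^α f denotes the iterated partial derivative of f along coordinate directions. (This realizes the paper's lemma that every finite set of constant-coefficient differential operators arises from linear functionals on End(E) for a suitable finite-dimensional O₀-module E.) -/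

import Mathlib

open Filter Topology

noncomputable section

namespace PaleyWiener

/-- The `ℂ`-algebra structure on germs of `ℂ`-valued functions, via constant germs. -/
instance germAlgebra {α : Type*} {l : Filter α} : Algebra ℂ (Filter.Germ l ℂ) :=
  Algebra.ofModule
    (fun c x y => by
      refine x.inductionOn fun f => y.inductionOn fun g => ?_
      rw [← Filter.Germ.coe_smul, ← Filter.Germ.coe_mul, ← Filter.Germ.coe_mul,
        ← Filter.Germ.coe_smul, smul_mul_assoc])
    (fun c x y => by
      refine x.inductionOn fun f => y.inductionOn fun g => ?_
      rw [← Filter.Germ.coe_smul, ← Filter.Germ.coe_mul, ← Filter.Germ.coe_mul,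
        ← Filter.Germ.coe_smul, mul_smul_comm])

variable (n : ℕ)

/-- The ring of germs at `0` of holomorphic functions on `ℂⁿ`, realized as the subalgebra of
`Filter.Germ (𝓝 0) ℂ` of germs admitting a representative analytic at `0`. -/
def O0 : Subalgebra ℂ (Filter.Germ (𝓝 (0 : Fin n → ℂ)) ℂ) where
  carrier := {g | ∃ f : (Fin n → ℂ) → ℂ, AnalyticAt ℂ f 0 ∧ g = ↑f}
  mul_mem' := by
    rintro a b ⟨f, hf, rfl⟩ ⟨g, hg, rfl⟩
    exact ⟨f * g, hf.mul hg, rfl⟩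
  add_mem' := by
    rintro a b ⟨f, hf, rfl⟩ ⟨g, hg, rfl⟩
    exact ⟨f + g, hf.add hg, rfl⟩
  algebraMap_mem' := fun c => ⟨fun _ => c, analyticAt_const, by
    rw [Algebra.algebraMap_eq_smul_one]
    have h : ((fun _ : Fin n → ℂ => c) : (Fin n → ℂ) → ℂ) = c • (1 : (Fin n → ℂ) → ℂ) := by
      funext x; simp
    rw [h, Filter.Germ.coe_smul, Filter.Germ.coe_one]⟩

/-- Evaluation at `0` of a germ at `𝓝 0`, as a ring homomorphism; this is well defined
since every neighborhood of `0` contains `0`. -/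
def germEval0 : Filter.Germ (𝓝 (0 : Fin n → ℂ)) ℂ →+* ℂ where
  toFun g := g.liftOn (fun f => f 0) fun _ _ h => h.self_of_nhds
  map_one' := rfl
  map_mul' a b := a.inductionOn₂ b fun _ _ => rfl
  map_zero' := rfl
  map_add' a b := a.inductionOn₂ b fun _ _ => rfl

/-- Evaluation at `0` on `O₀`. -/
def evalO0 : O0 n →+* ℂ := (germEval0 n).comp ((O0 n).val : O0 n →ₐ[ℂ] _).toRingHom

/-- The maximal ideal `M` of `O₀`, consisting of the germs vanishing at `0`. -/
def Mideal : Ideal (O0 n) := RingHom.ker (evalO0 n)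

end PaleyWiener

namespace PaleyWiener

/-- The partial derivative of `f : ℂⁿ → ℂ` in the `i`-th coordinate direction. -/
def pdi (n : ℕ) (i : Fin n) (f : (Fin n → ℂ) → ℂ) : (Fin n → ℂ) → ℂ :=
  fun x => fderiv ℂ f x (Pi.single i 1)

/-- The iterated partial derivative `∂^α f` of `f : ℂⁿ → ℂ` along the coordinate directions,
for a multi-index `α`. -/
def pdMulti (n : ℕ) (α : Fin n →₀ ℕ) (f : (Fin n → ℂ) → ℂ) : (Fin n → ℂ) → ℂ :=
  (List.finRange n).foldr (fun i g => (pdi n i)^[α i] g) f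

/-- The germ at `0` of `λ ↦ f (μ + λ)`, for `f` analytic at `μ`, as an element of `O₀`. -/
def shiftGerm (n : ℕ) (μ : Fin n → ℂ) (f : (Fin n → ℂ) → ℂ) (hf : AnalyticAt ℂ f μ) :
    O0 n :=
  ⟨(↑(fun t : Fin n → ℂ => f (μ + t)) : Filter.Germ (nhds (0 : Fin n → ℂ)) ℂ),
    fun t : Fin n → ℂ => f (μ + t), by
      have h1 : AnalyticAt ℂ (fun t : Fin n → ℂ => μ + t) 0 :=
        analyticAt_const.add analyticAt_id
      have h2 : AnalyticAt ℂ f ((fun t : Fin n → ℂ => μ + t) 0) := by simpa using hf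
      exact h2.comp h1, rfl⟩

/-- For an `O₀`-module `E`, an open `Ω ⊆ ℂⁿ`, `f` analytic on `Ω` and `μ ∈ Ω`, the
endomorphism `f^{(E)}(μ) ∈ End_ℂ(E)`, given by `e ↦ g • e` where `g ∈ O₀` is the germ at `0`
of `λ ↦ f(μ + λ)`. -/
def fE (n : ℕ) (E : Type*) [AddCommGroup E] [Module ℂ E] [Module (O0 n) E]
    [IsScalarTower ℂ (O0 n) E] (μ : Fin n → ℂ) (f : (Fin n → ℂ) → ℂ)
    (hf : AnalyticAt ℂ f μ) : Module.End ℂ E where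
  toFun e := shiftGerm n μ f hf • e
  map_add' x y := smul_add _ x y
  map_smul' c x := (smul_comm c (shiftGerm n μ f hf) x).symm

end PaleyWiener

namespace PaleyWiener

/-- The element of `O₀` given by a function analytic at `0`. -/
def mkO (n : ℕ) (f : (Fin n → ℂ) → ℂ) (hf : AnalyticAt ℂ f 0) : O0 n :=
  ⟨(f : Filter.Germ (𝓝 (0 : Fin n → ℂ)) ℂ), f, hf, rfl⟩

lemma mkO_surj (n : ℕ) (g : O0 n) : ∃ f, ∃ hf : AnalyticAt ℂ f 0, g = mkO n f hf := by
  obtain ⟨g, f, hf, rfl⟩ := g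
  exact ⟨f, hf, rfl⟩

lemma mkO_eq {n : ℕ} {f g : (Fin n → ℂ) → ℂ} {hf : AnalyticAt ℂ f 0} {hg : AnalyticAt ℂ g 0} :
    mkO n f hf = mkO n g hg ↔ f =ᶠ[𝓝 0] g := by
  exact Subtype.ext_iff.trans Filter.Germ.coe_eq

lemma pdi_analytic {n : ℕ} (i : Fin n) {f : (Fin n → ℂ) → ℂ} {x : Fin n → ℂ}
    (hf : AnalyticAt ℂ f x) : AnalyticAt ℂ (pdi n i f) x := by
  exact ((ContinuousLinearMap.apply ℂ ℂ (Pi.single i 1 : Fin n → ℂ)).analyticAt _).comp hf.fderiv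

lemma pdi_congr {n : ℕ} (i : Fin n) {f g : (Fin n → ℂ) → ℂ} {x : Fin n → ℂ}
    (h : f =ᶠ[𝓝 x] g) : pdi n i f =ᶠ[𝓝 x] pdi n i g := by
  filter_upwards [h.fderiv (𝕜 := ℂ)] with y hy
  simp only [pdi, hy]

/-- Underlying function of the derivation. -/
def dFun (n : ℕ) (i : Fin n) (g : O0 n) : O0 n :=
  mkO n (pdi n i (mkO_surj n g).choose) (pdi_analytic i (mkO_surj n g).choose_spec.choose)

lemma dFun_mkO {n : ℕ} (i : Fin n) (f : (Fin n → ℂ) → ℂ) (hf : AnalyticAt ℂ f 0) :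
    dFun n i (mkO n f hf) = mkO n (pdi n i f) (pdi_analytic i hf) := by
  unfold dFun
  rw [mkO_eq]
  apply pdi_congr
  have h := (mkO_surj n (mkO n f hf)).choose_spec.choose_spec
  exact (mkO_eq.1 h).symm

lemma mkO_add {n : ℕ} {f g : (Fin n → ℂ) → ℂ} (hf : AnalyticAt ℂ f 0) (hg : AnalyticAt ℂ g 0) :
    mkO n f hf + mkO n g hg = mkO n (f + g) (hf.add hg) := rfl

lemma mkO_mul {n : ℕ} {f g : (Fin n → ℂ) → ℂ} (hf : AnalyticAt ℂ f 0) (hg : AnalyticAt ℂ g 0) :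
    mkO n f hf * mkO n g hg = mkO n (f * g) (hf.mul hg) := rfl

lemma mkO_smul {n : ℕ} (c : ℂ) {f : (Fin n → ℂ) → ℂ} (hf : AnalyticAt ℂ f 0) :
    c • mkO n f hf = mkO n (c • f) (hf.const_smul) := rfl

lemma ev_diff {n : ℕ} {f : (Fin n → ℂ) → ℂ} (hf : AnalyticAt ℂ f 0) :
    ∀ᶠ x in 𝓝 (0 : Fin n → ℂ), DifferentiableAt ℂ f x :=
  hf.eventually_analyticAt.mono fun _ h => h.differentiableAt

/-- The partial derivative on germs. -/
def dLin (n : ℕ) (i : Fin n) : O0 n →ₗ[ℂ] O0 n where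
  toFun := dFun n i
  map_add' a b := by
    obtain ⟨f, hf, rfl⟩ := mkO_surj n a
    obtain ⟨g, hg, rfl⟩ := mkO_surj n b
    rw [mkO_add, dFun_mkO, dFun_mkO, dFun_mkO, mkO_add, mkO_eq]
    filter_upwards [ev_diff hf, ev_diff hg] with x h1 h2
    simp [pdi, fderiv_add h1 h2]
  map_smul' c a := by
    obtain ⟨f, hf, rfl⟩ := mkO_surj n a
    rw [mkO_smul, dFun_mkO, dFun_mkO, RingHom.id_apply, mkO_smul, mkO_eq]
    filter_upwards [ev_diff hf] with x h1
    simp [pdi, fderiv_const_smul h1 c]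

lemma dLin_mkO {n : ℕ} (i : Fin n) (f : (Fin n → ℂ) → ℂ) (hf : AnalyticAt ℂ f 0) :
    dLin n i (mkO n f hf) = mkO n (pdi n i f) (pdi_analytic i hf) := dFun_mkO i f hf

lemma dLin_mul {n : ℕ} (i : Fin n) (a b : O0 n) :
    dLin n i (a * b) = a * dLin n i b + b * dLin n i a := by
  obtain ⟨f, hf, rfl⟩ := mkO_surj n a
  obtain ⟨g, hg, rfl⟩ := mkO_surj n b
  rw [mkO_mul, dLin_mkO, dLin_mkO, dLin_mkO, mkO_mul, mkO_mul, mkO_add, mkO_eq]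
  filter_upwards [ev_diff hf, ev_diff hg] with x h1 h2
  simp [pdi, fderiv_mul h1 h2]

lemma dLin_pow {n : ℕ} (i : Fin n) (j : ℕ) : ∀ a ∈ Mideal n ^ (j + 1),
    dLin n i a ∈ Mideal n ^ j := by
  induction j with
  | zero => intro a _; simp
  | succ j ih =>
    intro a ha
    rw [pow_succ] at ha
    refine Submodule.mul_induction_on ha ?_ ?_
    · intro x hx y hy
      rw [dLin_mul]
      refine add_mem (Ideal.mul_mem_right _ _ hx) ?_
      rw [pow_succ, mul_comm y]
      exact Ideal.mul_mem_mul (ih x hx) hy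
    · intro x y hx hy
      rw [map_add]
      exact add_mem hx hy

lemma dLin_iter_pow {n : ℕ} (i : Fin n) (d j : ℕ) : ∀ a ∈ Mideal n ^ (j + d),
    (dLin n i ^ d) a ∈ Mideal n ^ j := by
  induction d with
  | zero => intro a ha; simpa using ha
  | succ d ih =>
    intro a ha
    rw [pow_succ, Module.End.mul_apply]
    exact ih _ (dLin_pow i _ _ ha)

lemma dLin_iter_mkO {n : ℕ} (i : Fin n) (d : ℕ) : ∀ (f : (Fin n → ℂ) → ℂ)
    (hf : AnalyticAt ℂ f 0), ∃ h, (dLin n i ^ d) (mkO n f hf) = mkO n ((pdi n i)^[d] f) h := by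
  induction d with
  | zero => intro f hf; exact ⟨hf, rfl⟩
  | succ d ih =>
    intro f hf
    rw [pow_succ, Module.End.mul_apply, dLin_mkO]
    exact ih _ _

/-- Iterated partial derivatives on germs. -/
def dList (n : ℕ) (α : Fin n →₀ ℕ) (l : List (Fin n)) : Module.End ℂ (O0 n) :=
  l.foldr (fun i T => dLin n i ^ α i * T) 1

lemma dList_mkO {n : ℕ} (α : Fin n →₀ ℕ) (f : (Fin n → ℂ) → ℂ) (hf : AnalyticAt ℂ f 0)
    (l : List (Fin n)) : ∃ h, dList n α l (mkO n f hf) =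
      mkO n (l.foldr (fun i g => (pdi n i)^[α i] g) f) h := by
  induction l with
  | nil => exact ⟨hf, rfl⟩
  | cons i l ih =>
    obtain ⟨h, e⟩ := ih
    obtain ⟨h', e'⟩ := dLin_iter_mkO i (α i) _ h
    refine ⟨h', ?_⟩
    exact (congrArg (dLin n i ^ α i) e).trans e'

lemma dList_pow {n : ℕ} (α : Fin n →₀ ℕ) (l : List (Fin n)) : ∀ (j : ℕ),
    ∀ a ∈ Mideal n ^ (j + (l.map α).sum), dList n α l a ∈ Mideal n ^ j := by
  induction l with
  | nil => intro j a ha; simpa [dList] using ha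
  | cons i l ih =>
    intro j a ha
    have : dList n α (i :: l) a = (dLin n i ^ α i) (dList n α l a) := rfl
    rw [this]
    apply dLin_iter_pow
    apply ih
    simpa [add_assoc] using ha

lemma pdi_iter_shift {n : ℕ} (μ : Fin n → ℂ) (i : Fin n) (d : ℕ) : ∀ (f : (Fin n → ℂ) → ℂ),
    (pdi n i)^[d] (fun t => f (μ + t)) = fun t => (pdi n i)^[d] f (μ + t) := by
  induction d with
  | zero => intro f; rfl
  | succ d ih =>
    intro f
    rw [Function.iterate_succ_apply, Function.iterate_succ_apply, ← ih]
    congr 1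
    funext t
    simp only [pdi]
    rw [fderiv_comp_add_left]

lemma foldr_shift {n : ℕ} (μ : Fin n → ℂ) (α : Fin n →₀ ℕ) (f : (Fin n → ℂ) → ℂ)
    (l : List (Fin n)) : l.foldr (fun i g => (pdi n i)^[α i] g) (fun t => f (μ + t)) =
      fun t => l.foldr (fun i g => (pdi n i)^[α i] g) f (μ + t) := by
  induction l with
  | nil => rfl
  | cons i l ih => rw [List.foldr_cons, ih, pdi_iter_shift]; rfl

/-- Evaluation as a linear map. -/
def evLin (n : ℕ) : O0 n →ₗ[ℂ] ℂ where
  toFun := evalO0 n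
  map_add' := map_add _
  map_smul' c a := by
    obtain ⟨f, hf, rfl⟩ := mkO_surj n a
    rfl

/-- The functional on `O₀`. -/
def LL (n : ℕ) (c : (Fin n →₀ ℕ) →₀ ℂ) : O0 n →ₗ[ℂ] ℂ :=
  ∑ α ∈ c.support, c α • (evLin n ∘ₗ dList n α (List.finRange n))

lemma LL_shift {n : ℕ} (c : (Fin n →₀ ℕ) →₀ ℂ) (μ : Fin n → ℂ) (f : (Fin n → ℂ) → ℂ)
    (hf : AnalyticAt ℂ f μ) :
    LL n c (shiftGerm n μ f hf) = c.sum fun α cα => cα * pdMulti n α f μ := by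
  rw [LL, LinearMap.sum_apply, Finsupp.sum]
  refine Finset.sum_congr rfl fun α _ => ?_
  rw [LinearMap.smul_apply, smul_eq_mul, LinearMap.comp_apply]
  congr 1
  have h0 : AnalyticAt ℂ (fun t : Fin n → ℂ => f (μ + t)) 0 := by
    have h1 : AnalyticAt ℂ (fun t : Fin n → ℂ => μ + t) 0 :=
      analyticAt_const.add analyticAt_id
    have h2 : AnalyticAt ℂ f ((fun t : Fin n → ℂ => μ + t) 0) := by simpa using hf
    exact h2.comp h1
  have e : shiftGerm n μ f hf = mkO n (fun t => f (μ + t)) h0 := rfl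
  obtain ⟨h, e'⟩ := dList_mkO α _ h0 (List.finRange n)
  rw [e, e']
  change (List.finRange n).foldr (fun i g => (pdi n i)^[α i] g) (fun t => f (μ + t)) 0 = _
  rw [foldr_shift]
  simp [pdMulti]

lemma LL_zero {n k : ℕ} (c : (Fin n →₀ ℕ) →₀ ℂ)
    (hc : ∀ α ∈ c.support, (α.sum fun _ d => d) ≤ k) (a : O0 n)
    (ha : a ∈ Mideal n ^ (k + 1)) : LL n c a = 0 := by
  rw [LL, LinearMap.sum_apply]
  refine Finset.sum_eq_zero fun α hα => ?_
  rw [LinearMap.smul_apply, LinearMap.comp_apply]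
  have hs : ((List.finRange n).map α).sum ≤ k := by
    have := hc α hα
    rw [Finsupp.sum_fintype _ _ (fun _ => rfl)] at this
    rwa [← List.ofFn_eq_map, List.sum_ofFn]
  have h1 : a ∈ Mideal n ^ (1 + ((List.finRange n).map α).sum) :=
    Ideal.pow_le_pow_right (by omega) ha
  have h2 := dList_pow α _ _ _ h1
  rw [pow_one] at h2
  have h3 : evLin n (dList n α (List.finRange n) a) = 0 := h2
  rw [h3, smul_zero]

set_option synthInstance.maxHeartbeats 1000000 in
set_option maxHeartbeats 2000000 in
/-- Fix `k ∈ ℕ` and a finitely supported family `c` supported on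
multi-indices of total degree at most `k`, and let `E := O₀/M^(k+1)`.  Then there is a
`ℂ`-linear functional `η` on `End_ℂ(E)` such that for every open `Ω ⊆ ℂⁿ`, every `f`
analytic at each point of `Ω` and every `μ ∈ Ω`:
`η(f^{(E)}(μ)) = Σ_α c_α (∂^α f)(μ)`. -/
theorem differential_operator_from_dual_of_End (n : ℕ) (hn : 1 ≤ n) (k : ℕ)
    (c : (Fin n →₀ ℕ) →₀ ℂ) (hc : ∀ α ∈ c.support, (α.sum fun _ d => d) ≤ k) :
    ∃ η : Module.End ℂ (O0 n ⧸ (Mideal n) ^ (k + 1)) →ₗ[ℂ] ℂ,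
      ∀ (Ω : Set (Fin n → ℂ)), IsOpen Ω →
      ∀ f : (Fin n → ℂ) → ℂ, ∀ hf : (∀ x ∈ Ω, AnalyticAt ℂ f x), ∀ μ, ∀ hμ : μ ∈ Ω,
        η (fE n (O0 n ⧸ (Mideal n) ^ (k + 1)) μ f (hf μ hμ)) =
          c.sum fun α cα => cα * pdMulti n α f μ := by
  obtain ⟨s, hs⟩ := LinearMap.exists_rightInverse_of_surjective
    (Ideal.Quotient.mkₐ ℂ (Mideal n ^ (k + 1))).toLinearMap
    (LinearMap.range_eq_top.2 (Ideal.Quotient.mkₐ_surjective ℂ _))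
  refine ⟨LL n c ∘ₗ s ∘ₗ LinearMap.applyₗ (1 : O0 n ⧸ (Mideal n) ^ (k + 1)), ?_⟩
  intro Ω _ f hf μ hμ
  rw [← LL_shift c μ f (hf μ hμ)]
  have e : fE n (O0 n ⧸ (Mideal n) ^ (k + 1)) μ f (hf μ hμ) 1 =
      Ideal.Quotient.mk (Mideal n ^ (k + 1)) (shiftGerm n μ f (hf μ hμ)) := by
    change Ideal.Quotient.mk (Mideal n ^ (k + 1)) (shiftGerm n μ f (hf μ hμ) * 1) = _
    rw [mul_one]
  rw [LinearMap.comp_apply, LinearMap.comp_apply, LinearMap.applyₗ_apply_apply, e]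
  rw [← sub_eq_zero, ← map_sub]
  apply LL_zero c hc
  rw [← Ideal.Quotient.eq]
  exact LinearMap.congr_fun hs _

end PaleyWiener
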